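/- For Lebesgue almost every λ ∈ (1/2, 0.668), there exists a constant κ > 0 such that for every n ∈ ℕ, 2^{n−1} ≤ #{a ∈ A_n(λ) : |a−b| > κ/(n² 2^n) for all b ∈ A_n(λ) with b ≠ a}. -/

import Mathlib

open MeasureTheory

/-- `A_n(λ) = {(1-λ) Σ_{k=1}^n i_k λ^{k-1} : (i_k) ∈ {0,1}^n} ⊆ ℝ`. -/
def Aset (lam : ℝ) (n : ℕ) : Set ℝ :=
  {x | ∃ i : Fin n → Fin 2, x = (1 - lam) * ∑ k : Fin n, ((i k : ℕ) : ℝ) * lam ^ (k : ℕ)}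

/-- The value at `x` of the polynomial with coefficient list `l`, constant term first. -/
def listEval : List ℤ → ℝ → ℝ
  | [], _ => 0
  | a :: l, x => a + x * listEval l x

/-- The value at `x` of the derivative of the polynomial with coefficient list `l`. -/
def listDeriv : List ℤ → ℝ → ℝ
  | [], _ => 0
  | _ :: l, x => listEval l x + x * listDeriv l x

/-- The value at `x` of the second derivative of the polynomial with coefficient list `l`. -/
def listDerivTwo : List ℤ → ℝ → ℝ
  | [], _ => 0
  | _ :: l, x => 2 * listDeriv l x + x * listDerivTwo l x

theorem hasDerivAt_listEval (l : List ℤ) (x : ℝ) :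
    HasDerivAt (listEval l) (listDeriv l x) x := by
  induction l with
  | nil => exact hasDerivAt_const x (0 : ℝ)
  | cons a l ih =>
    have h := ((hasDerivAt_id x).mul ih).const_add (a : ℝ)
    rw [one_mul] at h
    exact h

theorem hasDerivAt_listDeriv (l : List ℤ) (x : ℝ) :
    HasDerivAt (listDeriv l) (listDerivTwo l x) x := by
  induction l with
  | nil => exact hasDerivAt_const x (0 : ℝ)
  | cons a l ih =>
    have h := (hasDerivAt_listEval l x).add ((hasDerivAt_id x).mul ih)
    rw [one_mul, ← add_assoc, id, ← two_mul] at h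
    exact h

theorem abs_add_mul_le {u v x A B : ℝ} (hx : 0 ≤ x) (hu : |u| ≤ A) (hv : |v| ≤ B) :
    |u + x * v| ≤ A + x * B := by
  calc |u + x * v| ≤ |u| + |x * v| := abs_add_le _ _
    _ = |u| + x * |v| := by rw [abs_mul, abs_of_nonneg hx]
    _ ≤ A + x * B := by gcongr

theorem abs_intCast_le_one {a : ℤ} (h : |a| ≤ 1) : |(a : ℝ)| ≤ 1 := by exact_mod_cast h

section Bounds

variable {l : List ℤ} {x : ℝ}

theorem abs_listEval_le (hl : ∀ a ∈ l, |a| ≤ 1) (hx : 0 ≤ x) (hx1 : x < 1) :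
    |listEval l x| ≤ 1 / (1 - x) := by
  have h1 : 0 < 1 - x := by linarith
  induction l with
  | nil => simpa [listEval] using hx1.le
  | cons a l ih =>
    rw [List.forall_mem_cons] at hl
    refine (abs_add_mul_le hx (abs_intCast_le_one hl.1) (ih hl.2)).trans_eq ?_
    field_simp; ring

theorem abs_listDeriv_le (hl : ∀ a ∈ l, |a| ≤ 1) (hx : 0 ≤ x) (hx1 : x < 1) :
    |listDeriv l x| ≤ 1 / (1 - x) ^ 2 := by
  have h1 : 0 < 1 - x := by linarith
  induction l with
  | nil => simp [listDeriv]; positivity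
  | cons a l ih =>
    rw [List.forall_mem_cons] at hl
    refine (abs_add_mul_le hx (abs_listEval_le hl.2 hx hx1) (ih hl.2)).trans_eq ?_
    field_simp; ring

theorem abs_listDerivTwo_le (hl : ∀ a ∈ l, |a| ≤ 1) (hx : 0 ≤ x) (hx1 : x < 1) :
    |listDerivTwo l x| ≤ 2 / (1 - x) ^ 3 := by
  have h1 : 0 < 1 - x := by linarith
  induction l with
  | nil => simp [listDerivTwo]; positivity
  | cons a l ih =>
    rw [List.forall_mem_cons] at hl
    have h2 : |2 * listDeriv l x| ≤ 2 * (1 / (1 - x) ^ 2) := by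
      rw [abs_mul, abs_two]
      gcongr
      exact abs_listDeriv_le hl.2 hx hx1
    refine (abs_add_mul_le hx h2 (ih hl.2)).trans_eq ?_
    field_simp; ring

theorem abs_listEval_sub_le (hl : ∀ a ∈ l, |a| ≤ 1) (hx : 0 ≤ x) (hx1 : x < 1) :
    |listEval l x - x * listDeriv l x| ≤ 1 + x ^ 2 / (1 - x) ^ 2 := by
  have h1 : 0 < 1 - x := by linarith
  cases l with
  | nil => simp only [listEval, listDeriv, mul_zero, sub_zero, abs_zero]; positivity
  | cons a l =>
    rw [List.forall_mem_cons] at hl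
    have h2 : |-listDeriv l x| ≤ 1 / (1 - x) ^ 2 := by
      rw [abs_neg]; exact abs_listDeriv_le hl.2 hx hx1
    have h := abs_add_mul_le (sq_nonneg x) (abs_intCast_le_one hl.1) h2
    rw [show listEval (a :: l) x - x * listDeriv (a :: l) x = a + x ^ 2 * -listDeriv l x by
      simp only [listEval, listDeriv]; ring]
    rwa [mul_one_div] at h

end Bounds

/-- A certificate, found by a search of depth at most `k` over the leading coefficients, that no
polynomial `f` with coefficients in `{-1, 0, 1}` satisfies both `|P f(x) - Y| ≤ a` and
`|P x f'(x) - Z| ≤ b` at the point `x = p / q`. -/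
def separated (p q : ℤ) : ℕ → ℤ → ℤ → ℤ → ℤ → ℤ → Bool
  | 0, _, _, _, _, _ => false
  | k + 1, P, Y, Z, a, b =>
    decide (P * q + (q - p) * a < (q - p) * |Y|) ||
    decide (P * (p * q) + (q - p) ^ 2 * b < (q - p) ^ 2 * |Z|) ||
    decide (P * ((q - p) ^ 2 + p ^ 2) + (q - p) ^ 2 * (a + b) < (q - p) ^ 2 * |Y - Z|) ||
    (separated p q k (P * p) (q * (Y + P)) (q * Z - q * (Y + P)) (q * a) (q * (a + b)) &&
     separated p q k (P * p) (q * Y) (q * Z - q * Y) (q * a) (q * (a + b)) &&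
     separated p q k (P * p) (q * (Y - P)) (q * Z - q * (Y - P)) (q * a) (q * (a + b)))

theorem step_bound {p q P Y Z a b c f g : ℝ} (hq : 0 < q)
    (hf : |P * (c + p / q * f) - Y| ≤ a) (hg : |P * (p / q * (f + g)) - Z| ≤ b) :
    |P * p * f - q * (Y - c * P)| ≤ q * a ∧
      |P * p * g - (q * Z - q * (Y - c * P))| ≤ q * (a + b) := by
  have h1 : P * p * f - q * (Y - c * P) = q * (P * (c + p / q * f) - Y) := by
    field_simp; ring
  have h2 : P * p * g - (q * Z - q * (Y - c * P)) =
      q * ((P * (p / q * (f + g)) - Z) - (P * (c + p / q * f) - Y)) := by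
    field_simp; ring
  rw [h1, h2, abs_mul, abs_mul, abs_of_pos hq]
  refine ⟨by gcongr, ?_⟩
  gcongr
  exact (abs_sub _ _).trans (by linarith)

theorem abs_le_of_abs_mul_sub_le {P f Y a B : ℝ} (hP : 0 < P) (h : |P * f - Y| ≤ a)
    (hB : |f| ≤ B) : |Y| ≤ P * B + a := by
  have h1 : |P * f| ≤ P * B := by rw [abs_mul, abs_of_pos hP]; gcongr
  have h2 := abs_sub (P * f) (P * f - Y)
  rw [sub_sub_cancel] at h2
  linarith

theorem separated_sound {p q : ℤ} (hp : 0 < p) (hpq : p < q) (k : ℕ) :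
    ∀ P Y Z a b : ℤ, separated p q k P Y Z a b = true → 0 < P →
      ∀ l : List ℤ, (∀ c ∈ l, |c| ≤ 1) → |P * listEval l (p / q) - Y| ≤ a →
        ¬ |P * (p / q * listDeriv l (p / q)) - Z| ≤ b := by
  have hp' : (0 : ℝ) < p := by exact_mod_cast hp
  have hpq' : (p : ℝ) < q := by exact_mod_cast hpq
  have hq' : (0 : ℝ) < q := hp'.trans hpq'
  have hr : (0 : ℝ) < q - p := by linarith
  have hx : (0 : ℝ) ≤ p / q := by positivity
  have hx1 : (p / q : ℝ) < 1 := by rwa [div_lt_one hq']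
  have hsub : 1 - (p / q : ℝ) = (q - p) / q := by field_simp
  induction k with
  | zero => simp [separated]
  | succ k ih =>
    intro P Y Z a b hsep hP l hl hf hg
    have hP' : (0 : ℝ) < P := by exact_mod_cast hP
    simp only [separated, Bool.or_eq_true, Bool.and_eq_true, decide_eq_true_eq] at hsep
    rcases hsep with ((h | h) | h) | ⟨⟨h1, h2⟩, h3⟩
    · have h' : (P * q + (q - p) * a : ℝ) < (q - p) * |(Y : ℝ)| := by exact_mod_cast h
      have := abs_le_of_abs_mul_sub_le hP' hf (abs_listEval_le hl hx hx1)
      rw [hsub] at this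
      have := mul_le_mul_of_nonneg_left this hr.le
      refine absurd (h'.trans_le this) (not_lt.2 (le_of_eq ?_))
      field_simp
    · have h' : (P * (p * q) + (q - p) ^ 2 * b : ℝ) < (q - p) ^ 2 * |(Z : ℝ)| := by
        exact_mod_cast h
      have hB : |(p / q * listDeriv l (p / q) : ℝ)| ≤ p / q * (1 / (1 - p / q) ^ 2) := by
        rw [abs_mul, abs_of_nonneg hx]
        gcongr
        exact abs_listDeriv_le hl hx hx1
      have := abs_le_of_abs_mul_sub_le hP' hg hB
      rw [hsub] at this
      have := mul_le_mul_of_nonneg_left this (sq_nonneg ((q : ℝ) - p))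
      refine absurd (h'.trans_le this) (not_lt.2 (le_of_eq ?_))
      field_simp
    · have h' : (P * ((q - p) ^ 2 + p ^ 2) + (q - p) ^ 2 * (a + b) : ℝ) <
          (q - p) ^ 2 * |(Y - Z : ℝ)| := by exact_mod_cast h
      have hfg : |P * (listEval l (p / q) - p / q * listDeriv l (p / q)) - (Y - Z : ℝ)| ≤
          a + b := by
        rw [show P * (listEval l (p / q) - p / q * listDeriv l (p / q)) - (Y - Z : ℝ) =
          (P * listEval l (p / q) - Y) - (P * (p / q * listDeriv l (p / q)) - Z) by ring]
        exact (abs_sub _ _).trans (add_le_add hf hg)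
      have := abs_le_of_abs_mul_sub_le hP' hfg (abs_listEval_sub_le hl hx hx1)
      rw [hsub] at this
      have := mul_le_mul_of_nonneg_left this (sq_nonneg ((q : ℝ) - p))
      refine absurd (h'.trans_le this) (not_lt.2 (le_of_eq ?_))
      field_simp
    · obtain ⟨c, l', hc, hl', hf', hg'⟩ : ∃ (c : ℤ) (l' : List ℤ), |c| ≤ 1 ∧
          (∀ c ∈ l', |c| ≤ 1) ∧ listEval l (p / q) = c + p / q * listEval l' (p / q) ∧
          listDeriv l (p / q) = listEval l' (p / q) + p / q * listDeriv l' (p / q) := by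
        cases l with
        | nil => exact ⟨0, [], by simp, by simp, by simp [listEval], by simp [listEval, listDeriv]⟩
        | cons c l =>
          rw [List.forall_mem_cons] at hl
          exact ⟨c, l, hl.1, hl.2, rfl, rfl⟩
      rw [hf'] at hf
      rw [hg'] at hg
      obtain ⟨hf2, hg2⟩ := step_bound hq' hf hg
      have hPp : 0 < P * p := mul_pos hP hp
      have key : separated p q k (P * p) (q * (Y - c * P)) (q * Z - q * (Y - c * P)) (q * a)
          (q * (a + b)) = true := by
        obtain rfl | rfl | rfl : c = -1 ∨ c = 0 ∨ c = 1 := by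
          rw [abs_le] at hc; omega
        · simpa using h1
        · simpa using h2
        · simpa using h3
      refine ih _ _ _ _ _ key hPp l' hl' ?_ ?_
      · push_cast; exact hf2
      · push_cast; exact hg2

theorem separated_centers : ∀ j : ℕ, j < 421 →
    separated (1250 + j) 2500 20 (10 ^ 6 * (1250 + j)) (2500 * (0 - 1 * 10 ^ 6))
      (2500 * 0 - 2500 * (0 - 1 * 10 ^ 6)) (2500 * 6) (2500 * (6 + 7600)) = true := by
  decide +kernel

theorem lt_abs_listEval_or_lt_abs_listDeriv {l : List ℤ} (hl : ∀ a ∈ l, |a| ≤ 1) {j : ℕ}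
    (hj : j < 421) {c : ℝ} (hc : c = (1250 + j) / 2500) :
    6 / 10 ^ 6 < |listEval (1 :: l) c| ∨ 7600 / 10 ^ 6 < |c * listDeriv (1 :: l) c| := by
  by_contra! h
  have h1 : |(10 ^ 6 : ℝ) * (1 + (1250 + j : ℝ) / 2500 * listEval l c) - 0| ≤ 6 := by
    rw [← hc, sub_zero, abs_mul, abs_of_pos (by positivity)]
    have := h.1
    rw [le_div_iff₀' (by positivity)] at this
    simpa [listEval] using this
  have h3 : |(10 ^ 6 : ℝ) * ((1250 + j : ℝ) / 2500 * (listEval l c + c * listDeriv l c)) - 0| ≤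
      7600 := by
    rw [← hc, sub_zero, abs_mul, abs_of_pos (by positivity)]
    have := h.2
    rw [le_div_iff₀' (by positivity)] at this
    simpa [listDeriv] using this
  obtain ⟨h4, h5⟩ := step_bound (by norm_num) h1 h3
  have hpq : (1250 + j : ℤ) < 2500 := by omega
  refine separated_sound (p := 1250 + j) (q := 2500) (by positivity) hpq _ _ _ _ _ _
    (separated_centers j hj) (by positivity) l hl ?_ ?_
  · push_cast
    rw [← hc]
    convert h4 using 3 <;> norm_num
  · push_cast
    rw [← hc]
    convert h5 using 3 <;> norm_num

theorem volume_abs_le_of_lower_bound {f f' : ℝ → ℝ} (hf : ∀ x, HasDerivAt f (f' x) x)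
    {u v η r : ℝ} (huv : u ≤ v) (hη : 0 < η) (hr : 0 ≤ r)
    (h : (∀ x ∈ Set.Icc u v, η ≤ |f x|) ∨ ∀ x ∈ Set.Icc u v, η ≤ |f' x|) :
    volume (Set.Icc u v ∩ {x | |f x| ≤ r}) ≤ ENNReal.ofReal ((4 + (v - u)) / η * r) := by
  rcases h with h | h
  · rcases lt_or_ge r η with hrη | hrη
    · rw [Set.eq_empty_of_forall_notMem (s := Set.Icc u v ∩ {x | |f x| ≤ r})]
      · simp
      · rintro x ⟨hx, hxr⟩
        exact absurd ((h x hx).trans hxr) (not_le.2 hrη)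
    · refine (measure_mono Set.inter_subset_left).trans ?_
      rw [Real.volume_Icc]
      refine ENNReal.ofReal_le_ofReal ?_
      rw [div_mul_eq_mul_div, le_div_iff₀ hη]
      nlinarith
  · rcases Set.eq_empty_or_nonempty (Set.Icc u v ∩ {x | |f x| ≤ r}) with he | ⟨y, hy, hyr⟩
    · simp [he]
    have hsub : Set.Icc u v ∩ {x | |f x| ≤ r} ⊆ Set.Icc (y - 2 * r / η) (y + 2 * r / η) := by
      rintro x ⟨hx, hxr⟩
      have hxy : η * |x - y| ≤ |f x - f y| := by
        rcases eq_or_ne x y with rfl | hne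
        · simp
        obtain ⟨z, hz, hz'⟩ : ∃ z ∈ Set.Icc u v, f x - f y = f' z * (x - y) := by
          rcases lt_or_gt_of_ne hne with hlt | hlt
          · obtain ⟨z, hz, hz'⟩ := exists_hasDerivAt_eq_slope f f' hlt
              (fun t _ => (hf t).continuousAt.continuousWithinAt) fun t _ => hf t
            refine ⟨z, ⟨hx.1.trans hz.1.le, hz.2.le.trans hy.2⟩, ?_⟩
            have : y - x ≠ 0 := by linarith
            rw [hz']; field_simp; ring
          · obtain ⟨z, hz, hz'⟩ := exists_hasDerivAt_eq_slope f f' hlt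
              (fun t _ => (hf t).continuousAt.continuousWithinAt) fun t _ => hf t
            refine ⟨z, ⟨hy.1.trans hz.1.le, hz.2.le.trans hx.2⟩, ?_⟩
            have : x - y ≠ 0 := by linarith
            rw [hz']; field_simp
        rw [hz', abs_mul]
        gcongr
        exact h z hz
      have h2 : |f x - f y| ≤ 2 * r := by
        have := abs_sub (f x) (f y)
        have h3 : |f x| ≤ r := hxr
        have h4 : |f y| ≤ r := hyr
        linarith
      have h5 : |x - y| ≤ 2 * r / η := by
        rw [le_div_iff₀' hη]; linarith
      rw [abs_le] at h5
      exact ⟨by linarith [h5.1], by linarith [h5.2]⟩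
    refine (measure_mono hsub).trans ?_
    rw [Real.volume_Icc]
    refine ENNReal.ofReal_le_ofReal ?_
    rw [show y + 2 * r / η - (y - 2 * r / η) = 4 / η * r by ring]
    gcongr
    linarith

theorem abs_sub_le_of_abs_deriv_le {f f' : ℝ → ℝ} (hf : ∀ x, HasDerivAt f (f' x) x)
    {u v M x y : ℝ} (hM : ∀ x ∈ Set.Icc u v, |f' x| ≤ M) (hx : x ∈ Set.Icc u v)
    (hy : y ∈ Set.Icc u v) : |f x - f y| ≤ M * |x - y| :=
  (convex_Icc u v).norm_image_sub_le_of_norm_hasDerivWithin_le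
    (fun t _ => (hf t).hasDerivWithinAt) hM hy hx

theorem volume_abs_listEval_le_near_center {l : List ℤ} (hl : ∀ a ∈ l, |a| ≤ 1) {j : ℕ}
    (hj : j < 421) {c r : ℝ} (hc : c = (1250 + j) / 2500) (hr : 0 ≤ r) :
    volume (Set.Icc (c - 1 / 5000) (c + 1 / 5000) ∩ {x | |listEval (1 :: l) x| ≤ r}) ≤
      ENNReal.ofReal (5000000 * r) := by
  have hl' : ∀ a ∈ 1 :: l, |a| ≤ 1 := List.forall_mem_cons.2 ⟨by simp, hl⟩
  have hj' : (j : ℝ) ≤ 420 := by exact_mod_cast Nat.le_of_lt_succ hj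
  have hj0 : (0 : ℝ) ≤ j := j.cast_nonneg
  have hc1 : 1 / 2 ≤ c := by rw [hc]; linarith
  have hc2 : c ≤ 0.668 := by rw [hc]; linarith
  set J := Set.Icc (c - 1 / 5000) (c + 1 / 5000)
  have hcJ : c ∈ J := ⟨by linarith, by linarith⟩
  have hdist : ∀ x ∈ J, |x - c| ≤ 1 / 5000 := fun x hx => by
    rw [abs_le]; exact ⟨by linarith [hx.1], by linarith [hx.2]⟩
  have hD2 : ∀ x ∈ J, |listDerivTwo (1 :: l) x| ≤ 56 := fun x hx => by
    have hx1 : 0 ≤ x := by linarith [hx.1]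
    have hx2 : x ≤ 0.6682 := by linarith [hx.2]
    refine (abs_listDerivTwo_le hl' hx1 (by linarith)).trans ?_
    calc 2 / (1 - x) ^ 3 ≤ 2 / (1 - 0.6682) ^ 3 := by gcongr
      _ ≤ 56 := by norm_num
  have hD : ∀ x ∈ J, |listDeriv (1 :: l) x - listDeriv (1 :: l) c| ≤ 0.0112 := fun x hx =>
    calc |listDeriv (1 :: l) x - listDeriv (1 :: l) c| ≤ 56 * |x - c| :=
          abs_sub_le_of_abs_deriv_le (hasDerivAt_listDeriv _) hD2 hx hcJ
      _ ≤ 56 * (1 / 5000) := by gcongr; exact hdist x hx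
      _ = 0.0112 := by norm_num
  refine (volume_abs_le_of_lower_bound (hasDerivAt_listEval _) (by linarith)
    (η := 1 / 10 ^ 6) (by norm_num) hr ?_).trans (ENNReal.ofReal_le_ofReal ?_)
  · rcases le_or_gt |listDeriv (1 :: l) c| 0.01134 with hd | hd
    · left
      intro x hx
      have hf : |listEval (1 :: l) x - listEval (1 :: l) c| ≤ 0.02254 * |x - c| := by
        refine abs_sub_le_of_abs_deriv_le (hasDerivAt_listEval _) (fun y hy => ?_) hx hcJ
        have := abs_sub_abs_le_abs_sub (listDeriv (1 :: l) y) (listDeriv (1 :: l) c)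
        linarith [hD y hy]
      have hfc : 6 / 10 ^ 6 < |listEval (1 :: l) c| := by
        refine (lt_abs_listEval_or_lt_abs_listDeriv hl hj hc).resolve_right (not_lt.2 ?_)
        rw [abs_mul, abs_of_nonneg (by linarith)]
        calc c * |listDeriv (1 :: l) c| ≤ 0.668 * 0.01134 := by gcongr
          _ ≤ _ := by norm_num
      have := abs_sub_abs_le_abs_sub (listEval (1 :: l) c) (listEval (1 :: l) x)
      rw [abs_sub_comm] at this
      linarith [hdist x hx]
    · right
      intro x hx
      have := abs_sub_abs_le_abs_sub (listDeriv (1 :: l) c) (listDeriv (1 :: l) x)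
      rw [abs_sub_comm] at this
      linarith [hD x hx]
  · gcongr
    norm_num

theorem volume_abs_listEval_le {l : List ℤ} (hl : ∀ a ∈ l, |a| ≤ 1) {r : ℝ} (hr : 0 ≤ r) :
    volume (Set.Icc (1 / 2) 0.668 ∩ {x | |listEval (1 :: l) x| ≤ r}) ≤
      ENNReal.ofReal (421 * 5000000 * r) := by
  have hsub : Set.Icc (1 / 2) 0.668 ∩ {x | |listEval (1 :: l) x| ≤ r} ⊆
      ⋃ j ∈ Finset.range 421, Set.Icc ((1250 + j : ℝ) / 2500 - 1 / 5000)
        ((1250 + j : ℝ) / 2500 + 1 / 5000) ∩ {x | |listEval (1 :: l) x| ≤ r} := by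
    rintro x ⟨⟨hx1, hx2⟩, hxr⟩
    have h0 : 0 ≤ (x - 1 / 2 + 1 / 5000) * 2500 := by linarith
    have h1 := Nat.floor_le h0
    have h2 := Nat.lt_floor_add_one ((x - 1 / 2 + 1 / 5000) * 2500)
    set j := ⌊(x - 1 / 2 + 1 / 5000) * 2500⌋₊
    have hj : j < 421 := by
      have : (j : ℝ) < 421 := by linarith
      exact_mod_cast this
    simp only [Set.mem_iUnion]
    exact ⟨j, Finset.mem_range.2 hj, ⟨by linarith, by linarith⟩, hxr⟩
  calc _ ≤ ∑ j ∈ Finset.range 421, volume (Set.Icc ((1250 + j : ℝ) / 2500 - 1 / 5000)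
        ((1250 + j : ℝ) / 2500 + 1 / 5000) ∩ {x | |listEval (1 :: l) x| ≤ r}) :=
      (measure_mono hsub).trans (measure_biUnion_finset_le _ _)
    _ ≤ ∑ _j ∈ Finset.range 421, ENNReal.ofReal (5000000 * r) :=
      Finset.sum_le_sum fun j hj =>
        volume_abs_listEval_le_near_center hl (Finset.mem_range.1 hj) rfl hr
    _ = ENNReal.ofReal (421 * 5000000 * r) := by
      rw [Finset.sum_const, Finset.card_range, nsmul_eq_mul, mul_assoc,
        ENNReal.ofReal_mul (by norm_num)]
      norm_num

/-- The coefficients of the difference of the polynomials with digits `i` and `j`. -/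
def wordDiff {n : ℕ} (i j : Fin n → Fin 2) : List ℤ :=
  List.ofFn fun k => ((i k : ℕ) : ℤ) - ((j k : ℕ) : ℤ)

theorem wordDiff_cons {n : ℕ} (a b : Fin 2) (i j : Fin n → Fin 2) :
    wordDiff (Fin.cons a i) (Fin.cons b j) = (((a : ℕ) : ℤ) - ((b : ℕ) : ℤ)) :: wordDiff i j := by
  simp [wordDiff, List.ofFn_succ]

theorem abs_le_one_of_mem_wordDiff {n : ℕ} (i j : Fin n → Fin 2) :
    ∀ a ∈ wordDiff i j, |a| ≤ 1 := by
  intro a ha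
  obtain ⟨k, rfl⟩ := (List.mem_ofFn' _ _).1 ha
  rw [abs_le]
  dsimp only
  have h1 := (i k).isLt
  have h2 := (j k).isLt
  omega

theorem listEval_ofFn {n : ℕ} (c : Fin n → ℤ) (x : ℝ) :
    listEval (List.ofFn c) x = ∑ k : Fin n, (c k : ℝ) * x ^ (k : ℕ) := by
  induction n with
  | zero => simp [listEval]
  | succ n ih =>
    rw [List.ofFn_succ, Fin.sum_univ_succ, listEval, ih, Finset.mul_sum]
    simp only [Fin.val_zero, pow_zero, mul_one, Fin.val_succ, pow_succ]
    congr 1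
    exact Finset.sum_congr rfl fun k _ => by ring

theorem listEval_wordDiff {n : ℕ} (i j : Fin n → Fin 2) (x : ℝ) :
    listEval (wordDiff i j) x =
      ∑ k : Fin n, ((i k : ℕ) : ℝ) * x ^ (k : ℕ) - ∑ k : Fin n, ((j k : ℕ) : ℝ) * x ^ (k : ℕ) := by
  rw [wordDiff, listEval_ofFn, ← Finset.sum_sub_distrib]
  exact Finset.sum_congr rfl fun k _ => by push_cast; ring

theorem abs_listEval_wordDiff_comm {n : ℕ} (i j : Fin n → Fin 2) (x : ℝ) :
    |listEval (wordDiff i j) x| = |listEval (wordDiff j i) x| := by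
  rw [listEval_wordDiff, listEval_wordDiff, abs_sub_comm]

theorem volume_close_of_head_ne {n : ℕ} {a b : Fin 2} (hab : a ≠ b) (i j : Fin n → Fin 2)
    {α s : ℝ} (hα : 1 / 2 ≤ α) (hs : 0 ≤ s) :
    volume.restrict (Set.Icc α 0.668)
        {x | |listEval (wordDiff (Fin.cons a i : Fin (n + 1) → Fin 2) (Fin.cons b j)) x| ≤ s} ≤
      ENNReal.ofReal (421 * 5000000 * s) := by
  wlog h : b < a generalizing a b i j
  · simp_rw [abs_listEval_wordDiff_comm (Fin.cons a i : Fin (n + 1) → Fin 2)]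
    exact this hab.symm j i (lt_of_le_of_ne (not_lt.1 h) hab)
  obtain ⟨rfl, rfl⟩ : a = 1 ∧ b = 0 := by omega
  rw [wordDiff_cons, Measure.restrict_apply' measurableSet_Icc, Set.inter_comm]
  refine (measure_mono (Set.inter_subset_inter_left _ (Set.Icc_subset_Icc_left hα))).trans ?_
  simpa using volume_abs_listEval_le (abs_le_one_of_mem_wordDiff i j) hs

theorem volume_close_of_head_eq {n : ℕ} (a : Fin 2) (i j : Fin n → Fin 2) {α s : ℝ}
    (hα : 0 < α) :
    volume.restrict (Set.Icc α 0.668)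
        {x | |listEval (wordDiff (Fin.cons a i : Fin (n + 1) → Fin 2) (Fin.cons a j)) x| ≤ s} ≤
      volume.restrict (Set.Icc α 0.668) {x | |listEval (wordDiff i j) x| ≤ s / α} := by
  rw [wordDiff_cons, Measure.restrict_apply' measurableSet_Icc,
    Measure.restrict_apply' measurableSet_Icc]
  refine measure_mono ?_
  rintro x ⟨hx, hxI⟩
  refine ⟨?_, hxI⟩
  have hx0 : 0 < x := hα.trans_le hxI.1
  simp only [Set.mem_ofPred_eq, sub_self, listEval, Int.cast_zero, zero_add, abs_mul,
    abs_of_pos hx0] at hx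
  rw [Set.mem_ofPred_eq, le_div_iff₀' hα]
  refine le_trans ?_ hx
  gcongr
  exact hxI.1

theorem sum_word_succ {n : ℕ} {M : Type*} [AddCommMonoid M] (F : (Fin (n + 1) → Fin 2) → M) :
    ∑ i, F i = ∑ a : Fin 2, ∑ i : Fin n → Fin 2, F (Fin.cons a i) := by
  rw [← (Fin.consEquiv fun _ => Fin 2).sum_comp, Fintype.sum_prod_type]
  rfl

theorem sum_volume_close_le {α : ℝ} (hα : 1 / 2 < α) (n : ℕ) :
    ∀ s : ℝ, 0 ≤ s → ∑ i : Fin n → Fin 2, ∑ j : Fin n → Fin 2, (if i = j then 0 else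
      volume.restrict (Set.Icc α 0.668) {x | |listEval (wordDiff i j) x| ≤ s}) ≤
        ENNReal.ofReal (421 * 5000000 / (2 - 1 / α) * 4 ^ n * s) := by
  have hα0 : 0 < α := by linarith
  have hK : 0 < 2 - 1 / α := by
    rw [sub_pos, div_lt_iff₀ hα0]; linarith
  induction n with
  | zero =>
    intro s hs
    simp
  | succ n ih =>
    intro s hs
    set μ := volume.restrict (Set.Icc α 0.668)
    set g : (Fin n → Fin 2) → (Fin n → Fin 2) → ENNReal := fun i j =>
      if i = j then 0 else μ {x | |listEval (wordDiff i j) x| ≤ s / α} with hg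
    set D : ENNReal := ENNReal.ofReal (421 * 5000000 * s) with hD
    have hpair : ∀ (a b : Fin 2) (i j : Fin n → Fin 2),
        (if (Fin.cons a i : Fin (n + 1) → Fin 2) = Fin.cons b j then 0 else
          μ {x | |listEval (wordDiff (Fin.cons a i : Fin (n + 1) → Fin 2) (Fin.cons b j)) x| ≤ s})
          ≤ if a = b then g i j else D := by
      intro a b i j
      by_cases hab : a = b
      · subst hab
        rw [if_pos rfl]
        by_cases hij : i = j
        · simp [hij]
        · rw [if_neg fun h => hij (Fin.cons_injective2 h).2]
          simp only [hg, if_neg hij]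
          exact volume_close_of_head_eq a i j hα0
      · rw [if_neg hab, if_neg fun h => hab (Fin.cons_injective2 h).1]
        exact volume_close_of_head_ne hab i j hα.le hs
    have hsum : ∑ i, ∑ j, g i j ≤ _ := ih (s / α) (by positivity)
    calc _ ≤ ∑ a : Fin 2, ∑ i : Fin n → Fin 2, ∑ b : Fin 2, ∑ j : Fin n → Fin 2,
          (if a = b then g i j else D) := by
          rw [sum_word_succ]
          gcongr with a _ i _
          rw [sum_word_succ]
          gcongr with b _ j _
          exact hpair a b i j
      _ = 2 * ∑ i, ∑ j, g i j + 2 * (2 ^ n * 2 ^ n) * D := by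
          simp only [Fin.sum_univ_two, Finset.sum_add_distrib]
          simp
          ring
      _ ≤ 2 * ENNReal.ofReal (421 * 5000000 / (2 - 1 / α) * 4 ^ n * (s / α)) +
          2 * (2 ^ n * 2 ^ n) * D := by gcongr
      _ = ENNReal.ofReal (2 * (421 * 5000000 / (2 - 1 / α) * 4 ^ n * (s / α)) +
          2 * (2 ^ n * 2 ^ n) * (421 * 5000000 * s)) := by
          have h2 : ENNReal.ofReal (2 * (2 ^ n * 2 ^ n)) = 2 * (2 ^ n * 2 ^ n) := by
            rw [ENNReal.ofReal_mul zero_le_two, ENNReal.ofReal_mul (by positivity),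
              ENNReal.ofReal_pow zero_le_two, ENNReal.ofReal_ofNat]
          rw [ENNReal.ofReal_add (by positivity) (by positivity),
            ENNReal.ofReal_mul (p := 2 * (2 ^ n * 2 ^ n)) (by positivity),
            ENNReal.ofReal_mul (p := 2) zero_le_two, h2, ENNReal.ofReal_ofNat]
      _ ≤ _ := by
          refine ENNReal.ofReal_le_ofReal (le_of_eq ?_)
          rw [← mul_pow, show (2 * 2 : ℝ) = 4 by norm_num]
          have h2 : 2 * α - 1 ≠ 0 := by linarith
          have h3 : 2 - 1 / α = (2 * α - 1) / α := by field_simp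
          rw [h3]
          field_simp
          ring

/-- The ordered pairs of distinct words whose polynomials differ by at most `s` at `x`. -/
noncomputable def closePairs (n : ℕ) (s x : ℝ) : Finset ((Fin n → Fin 2) × (Fin n → Fin 2)) :=
  {p | p.1 ≠ p.2 ∧ |listEval (wordDiff p.1 p.2) x| ≤ s}

theorem measure_many_closePairs_le {α : ℝ} (hα : 1 / 2 < α) (n : ℕ) {s : ℝ} (hs : 0 ≤ s) :
    volume.restrict (Set.Icc α 0.668) {x | 2 ^ n < 2 * (closePairs n s x).card} ≤
      ENNReal.ofReal (421 * 5000000 / (2 - 1 / α) * 2 ^ (n + 1) * s) := by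
  set μ := volume.restrict (Set.Icc α 0.668)
  set U : (Fin n → Fin 2) → (Fin n → Fin 2) → Set ℝ := fun i j =>
    {x | |listEval (wordDiff i j) x| ≤ s} with hU
  have hmeas : ∀ i j, MeasurableSet (U i j) := fun i j => by
    have hc : Continuous (listEval (wordDiff i j)) :=
      continuous_iff_continuousAt.2 fun x => (hasDerivAt_listEval _ x).continuousAt
    exact (isClosed_le hc.abs continuous_const).measurableSet
  set N : ℝ → ENNReal := fun x => ∑ i, ∑ j, if i = j then 0 else (U i j).indicator 1 x
  have hNmeas : ∀ i j, Measurable fun x : ℝ =>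
      if i = j then (0 : ENNReal) else (U i j).indicator 1 x := fun i j => by
    by_cases hij : i = j
    · simp [hij]
    · simpa [hij] using measurable_one.indicator (hmeas i j)
  have hcard : ∀ x, ((closePairs n s x).card : ENNReal) = N x := by
    intro x
    rw [closePairs, Finset.card_filter, Nat.cast_sum, Fintype.sum_prod_type]
    refine Finset.sum_congr rfl fun i _ => Finset.sum_congr rfl fun j _ => ?_
    by_cases hij : i = j <;> simp [hij, hU, Set.indicator_apply]
  have hint : ∫⁻ x, N x ∂μ = ∑ i, ∑ j, if i = j then 0 else μ (U i j) := by
    rw [lintegral_finsetSum _ fun i _ => Finset.measurable_sum _ fun j _ => hNmeas i j]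
    refine Finset.sum_congr rfl fun i _ => ?_
    rw [lintegral_finsetSum _ fun j _ => hNmeas i j]
    refine Finset.sum_congr rfl fun j _ => ?_
    by_cases hij : i = j
    · simp [hij]
    · simp only [hij, if_false]
      exact lintegral_indicator_one (hmeas i j)
  have hK : 0 < 2 - 1 / α := by
    rw [sub_pos, div_lt_iff₀ (by linarith)]; linarith
  have hmarkov : 2 ^ n * μ {x | 2 ^ n < 2 * (closePairs n s x).card} ≤
      2 * ENNReal.ofReal (421 * 5000000 / (2 - 1 / α) * 4 ^ n * s) :=
    calc _ ≤ 2 ^ n * μ {x | 2 ^ n ≤ 2 * N x} := by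
          gcongr with x
          intro hx
          rw [← hcard]
          exact_mod_cast hx.le
      _ ≤ ∫⁻ x, 2 * N x ∂μ := mul_meas_ge_le_lintegral
          ((Finset.measurable_sum _ fun i _ =>
            Finset.measurable_sum _ fun j _ => hNmeas i j).const_mul 2) _
      _ = 2 * ∑ i, ∑ j, if i = j then 0 else μ (U i j) := by
          rw [lintegral_const_mul _ (Finset.measurable_sum _ fun i _ =>
            Finset.measurable_sum _ fun j _ => hNmeas i j), hint]
      _ ≤ _ := by
          gcongr
          exact sum_volume_close_le hα n s hs
  have h2 : (2 : ENNReal) * ENNReal.ofReal (421 * 5000000 / (2 - 1 / α) * 4 ^ n * s) =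
      2 ^ n * ENNReal.ofReal (421 * 5000000 / (2 - 1 / α) * 2 ^ (n + 1) * s) := by
    rw [← ENNReal.ofReal_ofNat 2, ← ENNReal.ofReal_pow (by norm_num),
      ← ENNReal.ofReal_mul (by norm_num), ← ENNReal.ofReal_mul (by positivity)]
    congr 1
    rw [show (4 : ℝ) = 2 * 2 by norm_num, mul_pow, pow_succ]
    ring
  rw [h2] at hmarkov
  exact (ENNReal.mul_le_mul_iff_right (by simp) (by finiteness)).1 hmarkov

theorem ae_exists_few_closePairs {α : ℝ} (hα : 1 / 2 < α) :
    ∀ᵐ x ∂volume.restrict (Set.Icc α 0.668), ∃ t > (0 : ℝ), ∀ n : ℕ,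
      2 * (closePairs n (t / ((n : ℝ) ^ 2 * 2 ^ n)) x).card ≤ 2 ^ n := by
  set μ := volume.restrict (Set.Icc α 0.668)
  have hK : 0 < 2 - 1 / α := by
    rw [sub_pos, div_lt_iff₀ (by linarith)]; linarith
  set K : ℝ := 421 * 5000000 / (2 - 1 / α) with hKdef
  have hK0 : 0 < K := by positivity
  have hsummable : Summable fun n : ℕ => K * 2 * (1 / (n : ℝ) ^ 2) :=
    (Real.summable_one_div_nat_pow.2 one_lt_two).mul_left _
  set S : ENNReal := ∑' n : ℕ, ENNReal.ofReal (K * 2 * (1 / (n : ℝ) ^ 2)) with hS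
  have hS' : S ≠ ⊤ := hsummable.tsum_ofReal_ne_top
  rw [ae_iff]
  have hbound : ∀ m : ℕ, μ {x | ¬ ∃ t > (0 : ℝ), ∀ n : ℕ,
      2 * (closePairs n (t / ((n : ℝ) ^ 2 * 2 ^ n)) x).card ≤ 2 ^ n} ≤
      ENNReal.ofReal (1 / ((m : ℝ) + 1)) * S := by
    intro m
    have ht : (0 : ℝ) < 1 / (m + 1) := by positivity
    set t : ℝ := 1 / (m + 1)
    calc _ ≤ μ (⋃ n : ℕ, {x | 2 ^ n < 2 * (closePairs n (t / ((n : ℝ) ^ 2 * 2 ^ n)) x).card}) := by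
          refine measure_mono fun x hx => ?_
          simp only [Set.mem_ofPred_eq, not_exists, not_and, not_forall, not_le] at hx
          exact Set.mem_iUnion.2 (hx t ht)
      _ ≤ ∑' n : ℕ, μ {x | 2 ^ n < 2 * (closePairs n (t / ((n : ℝ) ^ 2 * 2 ^ n)) x).card} :=
          measure_iUnion_le _
      _ ≤ ∑' n : ℕ, ENNReal.ofReal t * ENNReal.ofReal (K * 2 * (1 / (n : ℝ) ^ 2)) := by
          refine ENNReal.tsum_le_tsum fun n => ?_
          refine (measure_many_closePairs_le hα n (by positivity)).trans_eq ?_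
          rw [← ENNReal.ofReal_mul ht.le, ← hKdef, pow_succ]
          congr 1
          field_simp
      _ = ENNReal.ofReal t * S := ENNReal.tsum_mul_left
  have hlim : Filter.Tendsto (fun m : ℕ => ENNReal.ofReal (1 / ((m : ℝ) + 1)) * S) Filter.atTop
      (nhds 0) := by
    have := ENNReal.Tendsto.mul_const (b := S)
      (ENNReal.tendsto_ofReal (tendsto_one_div_add_atTop_nhds_zero_nat (𝕜 := ℝ))) (Or.inr hS')
    simpa using this
  exact le_antisymm (ge_of_tendsto' hlim hbound) zero_le

theorem ncard_separated_of_few_closePairs {x s : ℝ} {n : ℕ} (hn : 1 ≤ n) (hx : x < 1)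
    (hs : 0 ≤ s) (h : 2 * (closePairs n s x).card ≤ 2 ^ n) :
    2 ^ (n - 1) ≤ {a ∈ Aset x n | ∀ b ∈ Aset x n, b ≠ a → (1 - x) * s < |a - b|}.ncard := by
  classical
  have hx' : 0 < 1 - x := by linarith
  set pt : (Fin n → Fin 2) → ℝ := fun i => (1 - x) * ∑ k : Fin n, ((i k : ℕ) : ℝ) * x ^ (k : ℕ)
    with hpt
  have hsub : ∀ i j, |pt i - pt j| = (1 - x) * |listEval (wordDiff i j) x| := fun i j => by
    rw [listEval_wordDiff, hpt, ← mul_sub, abs_mul, abs_of_pos hx']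
  set G : Finset (Fin n → Fin 2) := {i | ∀ j, j ≠ i → s < |listEval (wordDiff i j) x|} with hG
  have hcard : 2 ^ n ≤ G.card + (closePairs n s x).card := by
    have hcover : (Finset.univ : Finset (Fin n → Fin 2)) ⊆
        G ∪ (closePairs n s x).image Prod.fst := by
      intro i _
      by_cases hi : i ∈ G
      · exact Finset.mem_union_left _ hi
      · simp only [hG, Finset.mem_filter_univ, not_forall, not_lt] at hi
        obtain ⟨j, hj, hj'⟩ := hi
        refine Finset.mem_union_right _ (Finset.mem_image.2 ⟨(i, j), ?_, rfl⟩)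
        simpa [closePairs] using ⟨hj.symm, hj'⟩
    calc 2 ^ n = (Finset.univ : Finset (Fin n → Fin 2)).card := by simp
      _ ≤ _ := Finset.card_le_card hcover
      _ ≤ _ := Finset.card_union_le _ _
      _ ≤ _ := by gcongr; exact Finset.card_image_le
  have hG2 : 2 ^ (n - 1) ≤ G.card := by
    have : 2 ^ n = 2 * 2 ^ (n - 1) := by rw [← pow_succ', Nat.sub_add_cancel hn]
    omega
  have hfar : ∀ i ∈ G, ∀ j, j ≠ i → (1 - x) * s < |pt i - pt j| := fun i hi j hj => by
    rw [hsub]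
    exact mul_lt_mul_of_pos_left ((Finset.mem_filter_univ _).1 hi j hj) hx'
  have hinj : Set.InjOn pt G := fun i hi j _ hij => by
    by_contra hne
    have := hfar i hi j (Ne.symm hne)
    rw [hij, sub_self, abs_zero] at this
    exact absurd this (not_lt.2 (by positivity))
  have hfin : (Aset x n).Finite := by
    refine (Set.finite_range pt).subset ?_
    rintro a ⟨i, rfl⟩
    exact ⟨i, rfl⟩
  calc 2 ^ (n - 1) ≤ G.card := hG2
    _ = (pt '' G).ncard := by rw [hinj.ncard_image, Set.ncard_coe_finset]
    _ ≤ _ := by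
      refine Set.ncard_le_ncard ?_ (hfin.subset (Set.sep_subset _ _))
      rintro _ ⟨i, hi, rfl⟩
      refine ⟨⟨i, rfl⟩, ?_⟩
      rintro _ ⟨j, rfl⟩ hne
      exact hfar i hi j fun h => hne (by rw [h])

/-- For Lebesgue almost every `λ ∈ (1/2, 0.668)`, there is `κ > 0` such that for every
`n ≥ 1`, at least `2^{n-1}` elements of `A_n(λ)` are `κ/(n² 2^n)`-separated from every
other element. -/
theorem generic_separation_uniform :
    ∀ᵐ lam ∂(volume.restrict (Set.Ioo (1 / 2 : ℝ) 0.668)),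
      ∃ κ > (0 : ℝ), ∀ n : ℕ, 1 ≤ n →
        2 ^ (n - 1) ≤
          {a ∈ Aset lam n |
            ∀ b ∈ Aset lam n, b ≠ a → κ / ((n : ℝ) ^ 2 * 2 ^ n) < |a - b|}.ncard := by
  have hcover : Set.Ioo (1 / 2 : ℝ) 0.668 ⊆
      ⋃ m : ℕ, Set.Icc (1 / 2 + 1 / ((m : ℝ) + 1)) 0.668 := by
    rintro x ⟨hx1, hx2⟩
    obtain ⟨m, hm⟩ := exists_nat_one_div_lt (sub_pos.2 hx1)
    exact Set.mem_iUnion.2 ⟨m, by linarith, hx2.le⟩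
  have hae : ∀ᵐ x ∂volume.restrict (Set.Ioo (1 / 2 : ℝ) 0.668), ∃ t > (0 : ℝ), ∀ n : ℕ,
      2 * (closePairs n (t / ((n : ℝ) ^ 2 * 2 ^ n)) x).card ≤ 2 ^ n := by
    refine ae_restrict_of_ae_restrict_of_subset hcover ?_
    rw [ae_restrict_iUnion_iff]
    exact fun m => ae_exists_few_closePairs (lt_add_of_pos_right _ (by positivity))
  filter_upwards [hae, ae_restrict_mem measurableSet_Ioo] with x ⟨t, ht, hclose⟩ hx
  have hx1 : x < 1 := hx.2.trans (by norm_num)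
  refine ⟨(1 - x) * t, mul_pos (sub_pos.2 hx1) ht, fun n hn => ?_⟩
  rw [mul_div_assoc]
  exact ncard_separated_of_few_closePairs hn hx1 (by positivity) (hclose n)
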